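/- Multi-agent BK Fixpoint Lemma (set version): Let n be a natural number, let A, A_1, …, A_n be sets, and let R_1 ⊆ A × A_1, …, R_{n+1} ⊆ A_n × A be a belief cycle satisfying the generalized BK assumptions: for every predicate p on A there exists c ∈ A such that (i) for every chain y_1, …, y_n with R_1(c, y_1), …, R_n(y_{n-1}, y_n) and every x ∈ A, R_{n+1}(y_n, x) ↔ p(x), and (ii) there exists y_1 with R_1(c, y_1), and every partial chain y_1, …, y_k (1 ≤ k ≤ n-1) from c extends by some y_{k+1} with R_{k+1}(y_k, y_{k+1}). Then every unary propositional operator O : Prop → Prop has a fixpoint, i.e. there exists a proposition s with O(s) ↔ s. -/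

import Mathlib

/-- A chain of length `k` for `Rs` extends by one further related element. -/
theorem exists_chain_succ {A : ℕ → Type*} (Rs : ∀ i : ℕ, A i → A (i + 1) → Prop) {k : ℕ}
    (y : ∀ i, i ≤ k → A i)
    (hy : ∀ i (h : i < k), Rs i (y i (Nat.le_of_lt h)) (y (i + 1) h))
    {z : A (k + 1)} (hz : Rs k (y k le_rfl) z) :
    ∃ w : ∀ i, i ≤ k + 1 → A i, w 0 (Nat.zero_le _) = y 0 (Nat.zero_le _) ∧
      ∀ i (h : i < k + 1), Rs i (w i (Nat.le_of_lt h)) (w (i + 1) h) := by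
  refine ⟨fun i h => if h' : i ≤ k then y i h' else
    (show i = k + 1 by omega) ▸ z, by simp, fun i h => ?_⟩
  rcases Nat.lt_succ_iff_lt_or_eq.mp h with hi | rfl
  · simpa [hi.le, Nat.succ_le_of_lt hi] using hy i hi
  · simpa using hz

/-- If every chain from `c` of length less than `n` extends, there is a chain of length `n`. -/
theorem exists_chain_of_extends {A : ℕ → Type*} (Rs : ∀ i : ℕ, A i → A (i + 1) → Prop)
    (c : A 0) (n : ℕ)
    (hext : ∀ k, k < n → ∀ y : ∀ i, i ≤ k → A i, y 0 (Nat.zero_le k) = c →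
      (∀ i (h : i < k), Rs i (y i (Nat.le_of_lt h)) (y (i + 1) h)) →
      ∃ z : A (k + 1), Rs k (y k le_rfl) z) :
    ∃ y : ∀ i, i ≤ n → A i, y 0 (Nat.zero_le n) = c ∧
      ∀ i (h : i < n), Rs i (y i (Nat.le_of_lt h)) (y (i + 1) h) := by
  induction n with
  | zero => exact ⟨fun i h => (Nat.le_zero.mp h) ▸ c, rfl, fun i h => absurd h i.not_lt_zero⟩
  | succ n ih =>
    obtain ⟨y, hy0, hy⟩ := ih fun k hk => hext k (Nat.lt_succ_of_lt hk)
    obtain ⟨z, hz⟩ := hext n n.lt_succ_self y hy0 hy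
    obtain ⟨w, hw0, hw⟩ := exists_chain_succ Rs y hy hz
    exact ⟨w, hw0.trans hy0, hw⟩

/-- Multi-agent BK Fixpoint Lemma (set version).

A belief cycle on sets `A 0, A 1, …, A n` is given by relations
`Rs i : A i → A (i+1) → Prop` for `i < n` (these are `R_1, …, R_n` of the
informal statement, so `Rs i = R_{i+1}`) together with the closing relation
`Rlast : A n → A 0 → Prop` (which is `R_{n+1}`).

Under the generalized BK assumptions — for every predicate `p` on `A 0` there
is a point `c` such that (i) along every full chain `y` from `c`, for all `x`,
`Rlast (y n) x ↔ p x`, and (ii) there is `y₁` with `R_1(c, y₁)` (when `n = 0`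
the first relation `R_1` is `Rlast` itself), and every partial chain from `c`
of length `k` with `1 ≤ k ≤ n - 1` extends — every unary propositional
operator `O : Prop → Prop` has a fixpoint. -/
theorem multiagent_bk_fixpoint (n : ℕ) (A : ℕ → Type*)
    (Rs : ∀ i : ℕ, A i → A (i + 1) → Prop) (Rlast : A n → A 0 → Prop)
    (H : ∀ p : A 0 → Prop, ∃ c : A 0,
      -- (i): along every full chain from `c`, the last relation assumes `p`
      (∀ y : ∀ i, i ≤ n → A i, y 0 (Nat.zero_le n) = c →
        (∀ i (h : i < n), Rs i (y i (Nat.le_of_lt h)) (y (i + 1) h)) →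
        ∀ x : A 0, Rlast (y n le_rfl) x ↔ p x) ∧
      -- (ii-a): there is `y₁` with `R_1 c y₁`
      (0 < n → ∃ y1 : A 1, Rs 0 c y1) ∧
      (∀ h : n = 0, ∃ y : A 0, (h ▸ Rlast) c y) ∧
      -- (ii-b): every partial chain from `c` of length `k`, `1 ≤ k ≤ n - 1`, extends
      (∀ k, 1 ≤ k → k ≤ n - 1 → ∀ y : ∀ i, i ≤ k → A i,
        y 0 (Nat.zero_le k) = c →
        (∀ i (h : i < k), Rs i (y i (Nat.le_of_lt h)) (y (i + 1) h)) →
        ∃ z : A (k + 1), Rs k (y k le_rfl) z)) :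
    ∀ O : Prop → Prop, ∃ s : Prop, O s ↔ s := by
  intro O
  let q : A 0 → Prop := fun x => ∃ y : ∀ i, i ≤ n → A i, y 0 (Nat.zero_le n) = x ∧
    (∀ i (h : i < n), Rs i (y i (Nat.le_of_lt h)) (y (i + 1) h)) ∧ Rlast (y n le_rfl) x
  obtain ⟨c, hp, hfirst, -, hext⟩ := H fun x => O (q x)
  refine ⟨q c, fun hO => ?_, fun ⟨y, hy0, hy, hl⟩ => (hp y hy0 hy c).mp hl⟩
  obtain ⟨y, hy0, hy⟩ := exists_chain_of_extends Rs c n fun k hk y hy0 hy => by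
    rcases k.eq_zero_or_pos with rfl | hpos
    · exact hy0 ▸ hfirst hk
    · exact hext k hpos (Nat.le_sub_one_of_lt hk) y hy0 hy
  exact ⟨y, hy0, hy, (hp y hy0 hy c).mpr hO⟩
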